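/- Let p be a continuous bounded probability density on [0,∞), c : ℝ₊ → ℝ with limsup_{y→∞} c(y)²/y < ∞, and p_N(x) = ∫₀^∞ p(tx) K_N(t,x) dt with K_N the generalized Post-Widder kernel. Then for every x > 0, lim_{N→∞} p_N(x) = p(x). -/

import Mathlib

open MeasureTheory

theorem integrableOn_pow_mul_exp_neg_mul_Ioi (k : ℕ) {r : ℝ} (hr : 0 < r) :
    IntegrableOn (fun t : ℝ => t ^ k * Real.exp (-(r * t))) (Set.Ioi 0) := by
  have h := integrableOn_rpow_mul_exp_neg_mul_rpow (p := 1) (s := k) (b := r)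
    (by have : (0 : ℝ) ≤ k := k.cast_nonneg
        linarith) one_pos hr
  simpa using h

theorem integral_pow_mul_exp_neg_mul_Ioi (k : ℕ) {r : ℝ} (hr : 0 < r) :
    ∫ t in Set.Ioi (0 : ℝ), t ^ k * Real.exp (-(r * t)) = (k.factorial : ℝ) / r ^ (k + 1) := by
  have h := Real.integral_rpow_mul_exp_neg_mul_Ioi (a := (k : ℝ) + 1) (r := r) (by positivity) hr
  rw [Real.Gamma_nat_eq_factorial] at h
  simp only [add_sub_cancel_right, Real.rpow_natCast] at h
  rw [h, ← Nat.cast_succ, Real.rpow_natCast, one_div, inv_pow, inv_mul_eq_div]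

theorem norm_pow_mul_cexp_neg_mul (k : ℕ) (r : ℂ) {t : ℝ} (ht : 0 ≤ t) :
    ‖(t : ℂ) ^ k * Complex.exp (-r * t)‖ = t ^ k * Real.exp (-(r.re * t)) := by
  rw [norm_mul, norm_pow, Complex.norm_real, Real.norm_of_nonneg ht, Complex.norm_exp]
  simp

theorem integrableOn_pow_mul_cexp_neg_mul_Ioi (k : ℕ) {r : ℂ} (hr : 0 < r.re) :
    IntegrableOn (fun t : ℝ => (t : ℂ) ^ k * Complex.exp (-r * t)) (Set.Ioi 0) :=
  (integrableOn_pow_mul_exp_neg_mul_Ioi k hr).mono'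
    (by fun_prop : Continuous fun t : ℝ => (t : ℂ) ^ k * Complex.exp (-r * t)).aestronglyMeasurable
    ((ae_restrict_iff' measurableSet_Ioi).2
      (.of_forall fun _ ht => (norm_pow_mul_cexp_neg_mul k r (le_of_lt ht)).le))

theorem integral_pow_mul_cexp_neg_mul_Ioi (k : ℕ) {r : ℂ} (hr : 0 < r.re) :
    ∫ t in Set.Ioi (0 : ℝ), (t : ℂ) ^ k * Complex.exp (-r * t) =
      (k.factorial : ℂ) / r ^ (k + 1) := by
  have hr0 : r ≠ 0 := fun h => by simp [h] at hr
  induction k with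
  | zero =>
    simp only [pow_zero, one_mul]
    rw [integral_exp_mul_complex_Ioi (by simpa using hr)]
    simp
  | succ k ih =>
    have hd : ∀ t ∈ Set.Ici (0 : ℝ),
        HasDerivAt (fun t : ℝ => (t : ℂ) ^ (k + 1) * Complex.exp (-r * t))
          (((k : ℂ) + 1) * ((t : ℂ) ^ k * Complex.exp (-r * t)) -
            r * ((t : ℂ) ^ (k + 1) * Complex.exp (-r * t))) t := fun t _ => by
      have h1 : HasDerivAt (fun z : ℂ => z ^ (k + 1) * Complex.exp (-r * z))
          (((k : ℂ) + 1) * ((t : ℂ) ^ k * Complex.exp (-r * t)) -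
            r * ((t : ℂ) ^ (k + 1) * Complex.exp (-r * t))) (t : ℂ) := by
        convert! (hasDerivAt_pow (k + 1) (t : ℂ)).mul
          ((hasDerivAt_id (t : ℂ)).const_mul (-r)).cexp using 1
        simp
        ring
      exact h1.comp_ofReal
    have hi := integrableOn_pow_mul_cexp_neg_mul_Ioi k hr
    have hi' := integrableOn_pow_mul_cexp_neg_mul_Ioi (k + 1) hr
    have hlim : Filter.Tendsto (fun t : ℝ => (t : ℂ) ^ (k + 1) * Complex.exp (-r * t))
        Filter.atTop (nhds 0) := by
      rw [tendsto_zero_iff_norm_tendsto_zero]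
      refine (tendsto_rpow_mul_exp_neg_mul_atTop_nhds_zero ((k + 1 : ℕ) : ℝ) r.re hr).congr' ?_
      filter_upwards [Filter.eventually_ge_atTop 0] with t ht
      rw [norm_pow_mul_cexp_neg_mul _ _ ht, Real.rpow_natCast, neg_mul]
    have h := integral_Ioi_of_hasDerivAt_of_tendsto' hd
      ((hi.const_mul _).sub (hi'.const_mul _)) hlim
    rw [integral_sub (hi.const_mul _) (hi'.const_mul _), integral_const_mul, integral_const_mul,
      ih] at h
    simp only [Complex.ofReal_zero, ne_eq, Nat.succ_ne_zero, not_false_eq_true, zero_pow,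
      zero_mul, sub_zero] at h
    rw [eq_div_iff (pow_ne_zero _ hr0), Nat.factorial_succ]
    have h2 := sub_eq_zero.1 h
    rw [mul_div_assoc', div_eq_iff (pow_ne_zero _ hr0)] at h2
    push_cast
    rw [h2]
    ring

/-- The density of the Gamma distribution of shape `N + 1` and rate `N`. -/
noncomputable def postWidderDensity (N : ℕ) (t : ℝ) : ℝ :=
  (N : ℝ) ^ (N + 1) / N.factorial * (t ^ N * Real.exp (-(N * t)))

theorem integrableOn_postWidderDensity {N : ℕ} (hN : 0 < N) :
    IntegrableOn (postWidderDensity N) (Set.Ioi 0) :=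
  (integrableOn_pow_mul_exp_neg_mul_Ioi N (Nat.cast_pos.2 hN)).const_mul _

theorem integral_postWidderDensity {N : ℕ} (hN : 0 < N) :
    ∫ t in Set.Ioi (0 : ℝ), postWidderDensity N t = 1 := by
  unfold postWidderDensity
  have hN' : (0 : ℝ) < N := Nat.cast_pos.2 hN
  rw [integral_const_mul, integral_pow_mul_exp_neg_mul_Ioi N hN']
  have := N.factorial_pos
  field_simp

theorem sq_sub_one_mul_postWidderDensity (N : ℕ) (t : ℝ) :
    (t - 1) ^ 2 * postWidderDensity N t = (N : ℝ) ^ (N + 1) / N.factorial *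
      (t ^ (N + 2) * Real.exp (-(N * t)) - 2 * (t ^ (N + 1) * Real.exp (-(N * t))) +
        t ^ N * Real.exp (-(N * t))) := by
  unfold postWidderDensity
  ring

theorem integrableOn_sq_sub_one_mul_postWidderDensity {N : ℕ} (hN : 0 < N) :
    IntegrableOn (fun t => (t - 1) ^ 2 * postWidderDensity N t) (Set.Ioi 0) := by
  simp only [sq_sub_one_mul_postWidderDensity]
  have hN' : (0 : ℝ) < N := Nat.cast_pos.2 hN
  have h := fun k => integrableOn_pow_mul_exp_neg_mul_Ioi k hN'
  exact (((h (N + 2)).sub ((h (N + 1)).const_mul 2)).add (h N)).const_mul _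

theorem integral_sq_sub_one_mul_postWidderDensity {N : ℕ} (hN : 0 < N) :
    ∫ t in Set.Ioi (0 : ℝ), (t - 1) ^ 2 * postWidderDensity N t = ((N : ℝ) + 2) / N ^ 2 := by
  simp only [sq_sub_one_mul_postWidderDensity]
  have hN' : (0 : ℝ) < N := Nat.cast_pos.2 hN
  have h := fun k => integrableOn_pow_mul_exp_neg_mul_Ioi k hN'
  have hI := fun k => integral_pow_mul_exp_neg_mul_Ioi k hN'
  rw [integral_const_mul,
    integral_add (by exact (h (N + 2)).sub ((h (N + 1)).const_mul 2)) (h N),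
    integral_sub (h (N + 2)) ((h (N + 1)).const_mul 2), integral_const_mul, hI, hI, hI,
    Nat.factorial_succ (N + 1), Nat.factorial_succ N]
  have := N.factorial_pos
  push_cast
  field_simp
  ring

theorem norm_natCast_add_I_mul_pow_le {N : ℕ} (hN : 0 < N) {b D : ℝ} (hD : 0 ≤ D)
    (hb : b ^ 2 ≤ D * N) :
    ‖(N : ℂ) + Complex.I * b‖ ^ (N + 1) ≤ Real.exp D * (N : ℝ) ^ (N + 1) := by
  have hN' : (1 : ℝ) ≤ N := Nat.one_le_cast.2 hN
  have hsq : ‖(N : ℂ) + Complex.I * b‖ ^ 2 = (N : ℝ) ^ 2 + b ^ 2 := by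
    rw [Complex.sq_norm, Complex.normSq_apply]
    simp
    ring
  have h1 : ‖(N : ℂ) + Complex.I * b‖ ^ 2 ≤ Real.exp (D / N) * (N : ℝ) ^ 2 := by
    rw [hsq]
    have h := mul_le_mul_of_nonneg_right (Real.add_one_le_exp (D / N)) (sq_nonneg (N : ℝ))
    have h' : (D / N + 1) * (N : ℝ) ^ 2 = D * N + N ^ 2 := by field_simp
    linarith
  refine le_of_sq_le_sq ?_ (by positivity)
  calc (‖(N : ℂ) + Complex.I * b‖ ^ (N + 1)) ^ 2
      = (‖(N : ℂ) + Complex.I * b‖ ^ 2) ^ (N + 1) := by rw [← pow_mul, ← pow_mul, mul_comm (N + 1)]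
    _ ≤ (Real.exp (D / N) * (N : ℝ) ^ 2) ^ (N + 1) := by gcongr
    _ = Real.exp ((N + 1 : ℕ) * (D / N)) * ((N : ℝ) ^ (N + 1)) ^ 2 := by
        rw [mul_pow, ← Real.exp_nat_mul]; ring
    _ ≤ Real.exp (2 * D) * ((N : ℝ) ^ (N + 1)) ^ 2 := by
        refine mul_le_mul_of_nonneg_right (Real.exp_le_exp.2 ?_) (by positivity)
        push_cast
        rw [mul_div_assoc', div_le_iff₀ (by linarith)]
        nlinarith
    _ = (Real.exp D * (N : ℝ) ^ (N + 1)) ^ 2 := by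
        rw [mul_pow, ← Real.exp_nat_mul]; norm_num

theorem exists_abs_sub_le_add_mul_sq {f : ℝ → ℝ} {a M ε : ℝ} (hf : ContinuousAt f a)
    (hM : ∀ t, |f t - f a| ≤ M) (hε : 0 < ε) :
    ∃ L, ∀ t, |f t - f a| ≤ ε + L * (t - a) ^ 2 := by
  obtain ⟨δ, hδ, h⟩ := Metric.continuousAt_iff.1 hf ε hε
  have hM0 : 0 ≤ M := (abs_nonneg _).trans (hM a)
  refine ⟨M / δ ^ 2, fun t => ?_⟩
  rcases lt_or_ge (dist t a) δ with ht | ht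
  · have h1 : |f t - f a| < ε := by simpa [Real.dist_eq] using h ht
    have : 0 ≤ M / δ ^ 2 * (t - a) ^ 2 := by positivity
    linarith
  · have h1 : δ ^ 2 ≤ (t - a) ^ 2 := by
      rw [← sq_abs (t - a), ← Real.dist_eq]
      gcongr
    have h2 : M ≤ M / δ ^ 2 * (t - a) ^ 2 := by
      rw [div_mul_eq_mul_div, le_div_iff₀ (by positivity)]
      gcongr
    linarith [hM t]

/-- pointwise convergence `p_N(x) → p(x)` of the generalized
Post-Widder approximation for a continuous bounded density `p` on `[0,∞)`. -/
theorem stmt_14 (p : ℝ → ℝ)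
    (hcont : Continuous p)
    (hnonneg : ∀ x, 0 ≤ p x)
    (hsupp : ∀ x < (0 : ℝ), p x = 0)
    (hint : ∫ x in Set.Ioi (0 : ℝ), p x = 1)
    (M : ℝ) (hbdd : ∀ x, p x ≤ M)
    (c : ℝ → ℝ)
    (hc : Filter.IsBoundedUnder (· ≤ ·) Filter.atTop (fun y => c y ^ 2 / y))
    (x : ℝ) (hx : 0 < x)
    (K : ℕ → ℝ → ℂ)
    (hK : ∀ (N : ℕ) (t : ℝ), K N t =
      (((N : ℂ) + Complex.I * x * c (N / x)) ^ (N + 1) / (Nat.factorial N : ℂ)) *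
        (t : ℂ) ^ N * Complex.exp (-((N : ℂ) + Complex.I * x * c (N / x)) * t)) :
    Filter.Tendsto (fun N : ℕ => ∫ t in Set.Ioi (0 : ℝ), (p (t * x) : ℂ) * K N t)
      Filter.atTop (nhds (p x : ℂ)) := by
  obtain ⟨B, hB⟩ := hc
  rw [Filter.eventually_map] at hB
  set D : ℝ := max B 0 * x with hDdef
  have hD : 0 ≤ D := by positivity
  have hKcont : ∀ N, Continuous (K N) := fun N => by
    rw [funext (hK N)]
    fun_prop
  have hKint : ∀ N : ℕ, 0 < N → ∫ t in Set.Ioi (0 : ℝ), K N t = 1 := fun N hN => by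
    have hre : 0 < ((N : ℂ) + Complex.I * x * c (N / x)).re := by simpa using hN
    have h0 : (N : ℂ) + Complex.I * x * c (N / x) ≠ 0 := fun h => by simp [h] at hre
    have hf : (N.factorial : ℂ) ≠ 0 := Nat.cast_ne_zero.2 N.factorial_ne_zero
    simp only [hK, mul_assoc (_ / _)]
    rw [integral_const_mul, integral_pow_mul_cexp_neg_mul_Ioi N hre]
    field_simp
  have hKle : ∀ᶠ N : ℕ in Filter.atTop, ∀ t ∈ Set.Ioi (0 : ℝ),
      ‖K N t‖ ≤ Real.exp D * postWidderDensity N t := by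
    have hlim : Filter.Tendsto (fun N : ℕ => (N : ℝ) / x) Filter.atTop Filter.atTop :=
      tendsto_natCast_atTop_atTop.atTop_div_const hx
    filter_upwards [hlim.eventually hB, Filter.eventually_gt_atTop 0] with N hBN hN t ht
    have hN' : (0 : ℝ) < N := Nat.cast_pos.2 hN
    have ht' : 0 < t := ht
    have hb : (x * c (N / x)) ^ 2 ≤ D * N := by
      have h1 : c (N / x) ^ 2 ≤ max B 0 * (N / x) :=
        (div_le_iff₀ (by positivity)).1 (hBN.trans (le_max_left _ _))
      calc (x * c (N / x)) ^ 2 = x ^ 2 * c (N / x) ^ 2 := by ring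
        _ ≤ x ^ 2 * (max B 0 * (N / x)) := by gcongr
        _ = D * N := by rw [hDdef]; field_simp
    have hnorm := norm_natCast_add_I_mul_pow_le hN hD hb
    push_cast at hnorm
    rw [hK, norm_mul, norm_mul, norm_div, norm_pow, norm_pow, Complex.norm_exp,
      Complex.norm_natCast, Complex.norm_real, Real.norm_of_nonneg ht'.le]
    have hexp : (-((N : ℂ) + Complex.I * x * c (N / x)) * t).re = -(N * t) := by simp
    rw [hexp, mul_assoc Complex.I]
    calc _ ≤ Real.exp D * (N : ℝ) ^ (N + 1) / N.factorial * t ^ N * Real.exp (-(N * t)) := by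
          gcongr
      _ = _ := by unfold postWidderDensity; ring
  rw [Metric.tendsto_nhds]
  intro ε hε
  set η : ℝ := ε / (2 * Real.exp D) with hη
  have hη0 : 0 < η := by positivity
  obtain ⟨L, hL⟩ := exists_abs_sub_le_add_mul_sq (f := fun t => p (t * x)) (a := 1) (M := M)
    (by fun_prop) (fun t => abs_sub_le_iff.2
      ⟨by linarith [hbdd (t * x), hnonneg (1 * x)], by linarith [hbdd (1 * x), hnonneg (t * x)]⟩)
    hη0
  simp only [one_mul] at hL
  have hvar : Filter.Tendsto (fun N : ℕ => L * (((N : ℝ) + 2) / N ^ 2)) Filter.atTop (nhds 0) := by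
    have h1 := tendsto_inv_atTop_nhds_zero_nat (𝕜 := ℝ)
    have h2 : Filter.Tendsto (fun N : ℕ => L * ((N : ℝ)⁻¹ + 2 * ((N : ℝ)⁻¹ * (N : ℝ)⁻¹)))
        Filter.atTop (nhds 0) := by
      simpa using ((h1.add ((h1.mul h1).const_mul 2)).const_mul L)
    refine h2.congr' ?_
    filter_upwards [Filter.eventually_gt_atTop 0] with N hN
    have hN' : (0 : ℝ) < N := Nat.cast_pos.2 hN
    field_simp
  filter_upwards [hKle, Filter.eventually_gt_atTop 0, hvar.eventually_lt_const hη0]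
    with N hle hN hsmall
  have hg := integrableOn_postWidderDensity hN
  have hg2 := integrableOn_sq_sub_one_mul_postWidderDensity hN
  have hKi : IntegrableOn (K N) (Set.Ioi 0) :=
    (hg.const_mul (Real.exp D)).mono' (hKcont N).aestronglyMeasurable
      ((ae_restrict_iff' measurableSet_Ioi).2 (.of_forall hle))
  have hpK : IntegrableOn (fun t => (p (t * x) : ℂ) * K N t) (Set.Ioi 0) := by
    refine hKi.bdd_mul (c := M) (by fun_prop) (.of_forall fun t => ?_)
    rw [Complex.norm_real, Real.norm_of_nonneg (hnonneg _)]
    exact hbdd _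
  have hbound : Integrable (fun t => Real.exp D *
      (η * postWidderDensity N t + L * ((t - 1) ^ 2 * postWidderDensity N t)))
      (volume.restrict (Set.Ioi 0)) :=
    ((hg.const_mul η).add (hg2.const_mul L)).const_mul _
  have hdiff : (∫ t in Set.Ioi (0 : ℝ), (p (t * x) : ℂ) * K N t) - p x =
      ∫ t in Set.Ioi (0 : ℝ), ((p (t * x) - p x : ℝ) : ℂ) * K N t := by
    have h : ∀ t, ((p (t * x) - p x : ℝ) : ℂ) * K N t =
        (p (t * x) : ℂ) * K N t - (p x : ℂ) * K N t := fun t => by push_cast; ring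
    simp only [h]
    rw [integral_sub hpK (hKi.const_mul _), integral_const_mul, hKint N hN, mul_one]
  rw [dist_eq_norm, hdiff]
  calc _ ≤ ∫ t in Set.Ioi (0 : ℝ), Real.exp D *
        (η * postWidderDensity N t + L * ((t - 1) ^ 2 * postWidderDensity N t)) := by
        refine norm_integral_le_of_norm_le hbound
          ((ae_restrict_iff' measurableSet_Ioi).2 (.of_forall fun t ht => ?_))
        rw [norm_mul, Complex.norm_real, Real.norm_eq_abs]
        calc _ ≤ (η + L * (t - 1) ^ 2) * (Real.exp D * postWidderDensity N t) :=
              mul_le_mul (hL t) (hle t ht) (norm_nonneg _) ((abs_nonneg _).trans (hL t))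
          _ = _ := by ring
    _ = Real.exp D * (η + L * (((N : ℝ) + 2) / N ^ 2)) := by
        rw [integral_const_mul, integral_add (hg.const_mul η) (hg2.const_mul L),
          integral_const_mul, integral_const_mul, integral_postWidderDensity hN,
          integral_sq_sub_one_mul_postWidderDensity hN, mul_one]
    _ < Real.exp D * (η + η) := by gcongr
    _ = ε := by rw [hη]; field_simp; ring
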